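/- Consider the linear control system ẋ = Ax + Bu on ℝⁿ and n-dimensional polytopes X, X' such that 0 ∈ X° ⊂ X'°. If the system is relaxed in-block controllable (RIBC) with respect to X through X', then: (i) (A,B) is controllable; (ii) there exists an n-dimensional compact convex set X₁ with X ⊆ X₁ ⊆ X' whose invariance conditions are solvable (for each x ∈ ∂X₁ there exists u ∈ ℝ^m with Ax + Bu ∈ T_{X₁}(x)); and (iii) there exists an n-dimensional compact convex set X₂ with X ⊆ X₂ ⊆ X' whose backward invariance conditions are solvable (for each x ∈ ∂X₂ there exists u ∈ ℝ^m with −Ax − Bu ∈ T_{X₂}(x)). -/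

import Mathlib

open Matrix Set Pointwise MeasureTheory

/-- Carathéodory (integral) solution of `ẋ = A x + B u + a` on `[0, T]`. -/
def IsSol {n m : ℕ} (A : Matrix (Fin n) (Fin n) ℝ) (B : Matrix (Fin n) (Fin m) ℝ)
    (a : Fin n → ℝ) (u : ℝ → Fin m → ℝ) (φ : ℝ → Fin n → ℝ) (T : ℝ) : Prop :=
  ∀ t ∈ Set.Icc (0 : ℝ) T,
    φ t = φ 0 + ∫ s in (0 : ℝ)..t, (A.mulVec (φ s) + B.mulVec (u s) + a)

/-- Controllability matrix `[B AB ⋯ A^{n-1}B]`. -/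
def ctrbMat {n m : ℕ} (A : Matrix (Fin n) (Fin n) ℝ) (B : Matrix (Fin n) (Fin m) ℝ) :
    Matrix (Fin n) (Fin n × Fin m) ℝ :=
  Matrix.of fun i p => ((A ^ (p.1 : ℕ)) * B) i p.2

/-- Kalman controllability of the pair `(A, B)`: the controllability matrix has rank `n`. -/
def Controllable {n m : ℕ} (A : Matrix (Fin n) (Fin n) ℝ)
    (B : Matrix (Fin n) (Fin m) ℝ) : Prop :=
  (ctrbMat A B).rank = n

/-- An `n`-dimensional polytope: convex hull of finitely many points, with nonempty interior. -/
def IsNPolytope {n : ℕ} (X : Set (Fin n → ℝ)) : Prop :=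
  (∃ V : Finset (Fin n → ℝ), X = convexHull ℝ (V : Set (Fin n → ℝ))) ∧ (interior X).Nonempty

/-- The set `𝒪` of possible equilibria of `ẋ = A x + B u + a`:
points `x` with `A x + a ∈ Im B`. -/
def equilSet {n m : ℕ} (A : Matrix (Fin n) (Fin n) ℝ) (B : Matrix (Fin n) (Fin m) ℝ)
    (a : Fin n → ℝ) : Set (Fin n → ℝ) :=
  {x | ∃ u : Fin m → ℝ, A.mulVec x + a = B.mulVec u}

/-- The Bouligand tangent cone to a set `S` at `x`. -/
def bouligand {n : ℕ} (S : Set (Fin n → ℝ)) (x : Fin n → ℝ) : Set (Fin n → ℝ) :=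
  {v | Filter.liminf (fun t : ℝ => Metric.infDist (x + t • v) S / t)
        (nhdsWithin 0 (Set.Ioi 0)) = 0}

/-- Relaxed in-block controllability of `ẋ = Ax + Bu + a` w.r.t. `X` through `X'`:
all states of `X°` are mutually accessible through `X'°` with uniformly bounded controls. -/
def RIBC {n m : ℕ} (A : Matrix (Fin n) (Fin n) ℝ) (B : Matrix (Fin n) (Fin m) ℝ)
    (a : Fin n → ℝ) (X X' : Set (Fin n → ℝ)) : Prop :=
  ∃ M > (0 : ℝ), ∀ x ∈ interior X, ∀ y ∈ interior X,
    ∃ T ≥ (0 : ℝ), ∃ u : ℝ → Fin m → ℝ, ∃ φ : ℝ → Fin n → ℝ,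
      Measurable u ∧ IsSol A B a u φ T ∧ φ 0 = x ∧ φ T = y ∧
      (∀ t ∈ Set.Icc (0 : ℝ) T, ‖u t‖ ≤ M) ∧
      (∀ t ∈ Set.Icc (0 : ℝ) T, φ t ∈ interior X')

open Filter Topology in
lemma tangent_aux {n m : ℕ} (A : Matrix (Fin n) (Fin n) ℝ) (B : Matrix (Fin n) (Fin m) ℝ)
    (C : Set (Fin n → ℝ)) (z : Fin n → ℝ) (M L δ : ℝ) (hδ : 0 < δ)
    (h : ∀ t : ℝ, 0 < t → t ≤ δ → ∃ w : Fin m → ℝ, ‖w‖ ≤ t * M ∧ ∃ c ∈ C,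
      ‖c - z - t • A.mulVec z - B.mulVec w‖ ≤ L * t ^ 2) :
    ∃ u : Fin m → ℝ, A.mulVec z + B.mulVec u ∈ bouligand C z := by
  set τ : ℕ → ℝ := fun j => δ / (j + 1) with hτ
  have hτ0 : ∀ j, 0 < τ j := fun j => by simp only [hτ]; positivity
  have hτδ : ∀ j, τ j ≤ δ := fun j => by
    simp only [hτ]
    apply div_le_self hδ.le
    have : (0 : ℝ) ≤ j := by positivity
    linarith
  have hτlim : Tendsto τ atTop (𝓝 0) := by
    simpa [hτ, div_eq_mul_inv] using
      (tendsto_one_div_add_atTop_nhds_zero_nat (𝕜 := ℝ)).const_mul δ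
  have h' : ∀ j, ∃ w : Fin m → ℝ, ‖w‖ ≤ τ j * M ∧ ∃ c ∈ C,
      ‖c - z - τ j • A.mulVec z - B.mulVec w‖ ≤ L * (τ j) ^ 2 := fun j => h _ (hτ0 j) (hτδ j)
  choose w hw c hc hcw using h'
  have hv : ∀ j, (τ j)⁻¹ • w j ∈ Metric.closedBall (0 : Fin m → ℝ) M := by
    intro j
    rw [mem_closedBall_zero_iff, norm_smul, norm_inv, Real.norm_of_nonneg (hτ0 j).le,
      inv_mul_le_iff₀ (hτ0 j)]
    exact hw j
  obtain ⟨u, -, σ, hσ, hu⟩ := (isCompact_closedBall (0 : Fin m → ℝ) M).tendsto_subseq hv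
  refine ⟨u, ?_⟩
  have hlim0 : Tendsto (fun j => τ (σ j)) atTop (𝓝 0) := hτlim.comp hσ.tendsto_atTop
  have hlim : Tendsto (fun j => τ (σ j)) atTop (𝓝[>] 0) :=
    tendsto_nhdsWithin_iff.2 ⟨hlim0, Eventually.of_forall fun j => hτ0 _⟩
  have hg : Tendsto (fun j => L * τ (σ j) + ‖B.mulVec ((τ (σ j))⁻¹ • w (σ j) - u)‖)
      atTop (𝓝 0) := by
    have h1 : Tendsto (fun j => (τ (σ j))⁻¹ • w (σ j) - u) atTop (𝓝 0) := by
      have := hu.sub_const u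
      simpa using this
    have h2 : Continuous fun v : Fin m → ℝ => ‖B.mulVec v‖ := by fun_prop
    have h3 := (h2.tendsto 0).comp h1
    have := (hlim0.const_mul L).add h3
    simpa using this
  have hle : ∀ j, Metric.infDist (z + τ (σ j) • (A.mulVec z + B.mulVec u)) C / τ (σ j) ≤
      L * τ (σ j) + ‖B.mulVec ((τ (σ j))⁻¹ • w (σ j) - u)‖ := by
    intro j
    generalize hk : σ j = k
    rw [div_le_iff₀ (hτ0 k)]
    refine (Metric.infDist_le_dist_of_mem (hc k)).trans ?_
    rw [dist_comm, dist_eq_norm]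
    have e : c k - (z + τ k • (A.mulVec z + B.mulVec u)) =
        (c k - z - τ k • A.mulVec z - B.mulVec (w k)) +
          τ k • B.mulVec ((τ k)⁻¹ • w k - u) := by
      rw [Matrix.mulVec_sub, Matrix.mulVec_smul, smul_sub, smul_smul,
        mul_inv_cancel₀ (hτ0 k).ne', one_smul, smul_add]
      abel
    rw [e]
    refine (norm_add_le _ _).trans ?_
    rw [norm_smul, Real.norm_of_nonneg (hτ0 k).le]
    have := hcw k
    nlinarith
  have hfreq : ∀ ε > 0, ∃ᶠ t in 𝓝[>] (0 : ℝ),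
      Metric.infDist (z + t • (A.mulVec z + B.mulVec u)) C / t ≤ ε := by
    intro ε hε
    apply hlim.frequently
    apply Eventually.frequently
    filter_upwards [hg.eventually (gt_mem_nhds hε)] with j hj
    exact (hle j).trans hj.le
  have hnn : ∀ᶠ t in 𝓝[>] (0 : ℝ),
      0 ≤ Metric.infDist (z + t • (A.mulVec z + B.mulVec u)) C / t := by
    filter_upwards [self_mem_nhdsWithin] with t ht
    exact div_nonneg Metric.infDist_nonneg (le_of_lt ht)
  refine le_antisymm ?_ ?_
  · refine le_of_forall_pos_le_add fun ε hε => ?_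
    rw [zero_add]
    exact liminf_le_of_frequently_le (hfreq ε hε) ⟨0, hnn⟩
  · exact le_liminf_of_le (IsCoboundedUnder.of_frequently_le (hfreq 1 one_pos)) hnn

lemma closed_aux {n m : ℕ} (A : Matrix (Fin n) (Fin n) ℝ) (B : Matrix (Fin n) (Fin m) ℝ)
    (C : Set (Fin n → ℝ)) (hC : IsCompact C) (hCc : Convex ℝ C) (r ε t : ℝ) :
    IsClosed {z : Fin n → ℝ | ∃ w : Fin m → ℝ, ‖w‖ ≤ r ∧ ∃ c ∈ C,
      ‖c - z - t • A.mulVec z - B.mulVec w‖ ≤ ε} ∧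
    Convex ℝ {z : Fin n → ℝ | ∃ w : Fin m → ℝ, ‖w‖ ≤ r ∧ ∃ c ∈ C,
      ‖c - z - t • A.mulVec z - B.mulVec w‖ ≤ ε} := by
  constructor
  · apply IsSeqClosed.isClosed
    intro x z hx hxz
    choose w hw c hc h using hx
    have hK : IsCompact (Metric.closedBall (0 : Fin m → ℝ) r ×ˢ C) :=
      (isCompact_closedBall _ _).prod hC
    obtain ⟨⟨w', c'⟩, hwc, σ, hσ, hlim⟩ := hK.tendsto_subseq (x := fun j => (w j, c j))
      (fun j => ⟨by simpa using hw j, hc j⟩)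
    refine ⟨w', by simpa using hwc.1, c', hwc.2, ?_⟩
    have hcont : Continuous fun q : (Fin n → ℝ) × ((Fin m → ℝ) × (Fin n → ℝ)) =>
        ‖q.2.2 - q.1 - t • A.mulVec q.1 - B.mulVec q.2.1‖ := by fun_prop
    have h2 := (hcont.tendsto (z, (w', c'))).comp
      ((hxz.comp hσ.tendsto_atTop).prodMk_nhds hlim)
    exact le_of_tendsto h2 (Filter.Eventually.of_forall fun j => h (σ j))
  · rintro z₁ ⟨w₁, hw₁, c₁, hc₁, h₁⟩ z₂ ⟨w₂, hw₂, c₂, hc₂, h₂⟩ a b ha hb hab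
    refine ⟨a • w₁ + b • w₂, ?_, a • c₁ + b • c₂, hCc hc₁ hc₂ ha hb hab, ?_⟩
    · have := convex_closedBall (0 : Fin m → ℝ) r (mem_closedBall_zero_iff.2 hw₁)
        (mem_closedBall_zero_iff.2 hw₂) ha hb hab
      simpa using this
    · have := convex_closedBall (0 : Fin n → ℝ) ε (mem_closedBall_zero_iff.2 h₁)
        (mem_closedBall_zero_iff.2 h₂) ha hb hab
      rw [mem_closedBall_zero_iff] at this
      refine le_trans (le_of_eq (congrArg norm ?_)) this
      simp only [Matrix.mulVec_add, Matrix.mulVec_smul]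
      module

lemma integ_aux {n m : ℕ} (A : Matrix (Fin n) (Fin n) ℝ) (B : Matrix (Fin n) (Fin m) ℝ)
    (u : ℝ → Fin m → ℝ) (φ : ℝ → Fin n → ℝ) (T M R : ℝ) (hT : 0 ≤ T)
    (hu : Measurable u) (hsol : IsSol A B 0 u φ T)
    (huM : ∀ t ∈ Set.Icc (0 : ℝ) T, ‖u t‖ ≤ M) (hφ : ∀ t ∈ Set.Icc (0 : ℝ) T, ‖φ t‖ ≤ R) :
    IntegrableOn u (Icc 0 T) ∧ IntegrableOn φ (Icc 0 T) := by
  have hbd : ∀ {k : ℕ} (g : ℝ → Fin k → ℝ) (K : ℝ),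
      AEStronglyMeasurable g (volume.restrict (Icc 0 T)) → (∀ t ∈ Icc (0 : ℝ) T, ‖g t‖ ≤ K) →
      IntegrableOn g (Icc 0 T) := by
    intro k g K hg hK
    refine Integrable.of_bound (C := K) hg ?_
    exact (ae_restrict_iff' measurableSet_Icc).2 (Filter.Eventually.of_forall hK)
  have hui : IntegrableOn u (Icc 0 T) := hbd u M hu.aestronglyMeasurable huM
  refine ⟨hui, hbd φ R ?_ hφ⟩
  set f : ℝ → Fin n → ℝ := fun s => A.mulVec (φ s) + B.mulVec (u s) + 0 with hf
  set S : Set ℝ := {t | t ∈ Icc 0 T ∧ IntervalIntegrable f volume 0 t} with hS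
  have h0S : (0 : ℝ) ∈ S := ⟨⟨le_rfl, hT⟩, by simp⟩
  have hSb : BddAbove S := ⟨T, fun t ht => ht.1.2⟩
  set τ := sSup S with hτ
  have hτ0 : 0 ≤ τ := le_csSup hSb h0S
  have hτT : τ ≤ T := csSup_le ⟨0, h0S⟩ fun t ht => ht.1.2
  have hcont : ∀ s ∈ S, ContinuousOn φ (Icc 0 s) := by
    rintro s ⟨hs, hsi⟩
    have h1 := intervalIntegral.continuousOn_primitive_interval
      ((intervalIntegrable_iff').1 hsi)
    rw [uIcc_of_le hs.1] at h1
    have h2 : ContinuousOn (fun t => φ 0 + ∫ r in (0 : ℝ)..t, f r) (Icc 0 s) :=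
      continuousOn_const.add h1
    exact h2.congr fun t ht => hsol t ⟨ht.1, ht.2.trans hs.2⟩
  have hc1 : ContinuousOn φ (Ico 0 τ) := by
    intro t ht
    obtain ⟨s, hs, hts⟩ := exists_lt_of_lt_csSup ⟨0, h0S⟩ ht.2
    have h1 := hcont s hs t ⟨ht.1, hts.le⟩
    refine h1.mono_of_mem_nhdsWithin ?_
    rw [mem_nhdsWithin]
    exact ⟨Iio s, isOpen_Iio, hts, fun r hr => ⟨hr.2.1, le_of_lt hr.1⟩⟩
  have hc2 : ContinuousOn φ (Ioc τ T) := by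
    refine (continuousOn_const (c := φ 0)).congr fun t ht => ?_
    have htI : t ∈ Icc 0 T := ⟨hτ0.trans ht.1.le, ht.2⟩
    rw [hsol t htI, intervalIntegral.integral_undef, add_zero]
    intro hi
    exact absurd (le_csSup hSb (show t ∈ S from ⟨htI, hi⟩)) (not_le.2 ht.1)
  have hsub : Icc 0 T = (Ico 0 τ ∪ {τ}) ∪ Ioc τ T := by
    ext t
    simp only [mem_Icc, mem_union, mem_Ico, mem_singleton_iff, mem_Ioc]
    constructor
    · rintro ⟨h1, h2⟩
      rcases lt_trichotomy t τ with h | h | h <;> tauto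
    · rintro ((h | h) | h)
      · exact ⟨h.1, h.2.le.trans hτT⟩
      · subst h; exact ⟨hτ0, hτT⟩
      · exact ⟨hτ0.trans h.1.le, h.2⟩
  rw [hsub, aestronglyMeasurable_union_iff, aestronglyMeasurable_union_iff]
  exact ⟨⟨hc1.aestronglyMeasurable measurableSet_Ico,
    (continuousOn_singleton φ τ).aestronglyMeasurable (measurableSet_singleton _)⟩,
    hc2.aestronglyMeasurable measurableSet_Ioc⟩

lemma clm_mulVec {k l : ℕ} (A : Matrix (Fin k) (Fin l) ℝ) :
    ∃ L : (Fin l → ℝ) →L[ℝ] (Fin k → ℝ), ∀ v, L v = A.mulVec v :=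
  ⟨LinearMap.toContinuousLinearMap A.mulVecLin, fun _ => rfl⟩

lemma step_aux {n m : ℕ} (A : Matrix (Fin n) (Fin n) ℝ) (B : Matrix (Fin n) (Fin m) ℝ)
    (u : ℝ → Fin m → ℝ) (φ : ℝ → Fin n → ℝ) (T M R a K : ℝ) (hT : 0 ≤ T)
    (hu : Measurable u) (hsol : IsSol A B 0 u φ T)
    (huM : ∀ t ∈ Set.Icc (0 : ℝ) T, ‖u t‖ ≤ M) (hφ : ∀ t ∈ Set.Icc (0 : ℝ) T, ‖φ t‖ ≤ R)
    (ha : ∀ v, ‖A.mulVec v‖ ≤ a * ‖v‖) (ha0 : 0 ≤ a) (hK0 : 0 ≤ K)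
    (hK : ∀ v w, ‖v‖ ≤ R → ‖w‖ ≤ M → ‖A.mulVec v + B.mulVec w‖ ≤ K)
    (s t : ℝ) (hs : 0 ≤ s) (hst : s ≤ t) (ht : t ≤ T) :
    ‖φ t - φ s‖ ≤ K * (t - s) ∧ ∃ w : Fin m → ℝ, ‖w‖ ≤ (t - s) * M ∧
      ‖φ t - φ s - (t - s) • A.mulVec (φ s) - B.mulVec w‖ ≤ a * K * (t - s) ^ 2 := by
  obtain ⟨hui, hφi⟩ := integ_aux A B u φ T M R hT hu hsol huM hφ
  obtain ⟨LA, hLA⟩ := clm_mulVec A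
  obtain ⟨LB, hLB⟩ := clm_mulVec B
  have hii : ∀ {k : ℕ} (g : ℝ → Fin k → ℝ), IntegrableOn g (Icc 0 T) →
      ∀ p q, 0 ≤ p → p ≤ q → q ≤ T → IntervalIntegrable g volume p q := by
    intro k g hg p q hp hpq hq
    rw [intervalIntegrable_iff_integrableOn_Icc_of_le hpq]
    exact hg.mono_set (Icc_subset_Icc hp hq)
  have hfi : IntegrableOn (fun r => A.mulVec (φ r) + B.mulVec (u r)) (Icc 0 T) := by
    have : Integrable (fun r => LA (φ r) + LB (u r)) (volume.restrict (Icc 0 T)) :=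
      (LA.integrable_comp hφi).add (LB.integrable_comp hui)
    simpa only [hLA, hLB, IntegrableOn] using this
  have hdiff : ∀ p q, 0 ≤ p → p ≤ q → q ≤ T →
      φ q - φ p = ∫ r in p..q, (A.mulVec (φ r) + B.mulVec (u r)) := by
    intro p q hp hpq hq
    have h1 := hsol q ⟨hp.trans hpq, hq⟩
    have h2 := hsol p ⟨hp, hpq.trans hq⟩
    simp only [add_zero] at h1 h2
    rw [h1, h2, ← intervalIntegral.integral_add_adjacent_intervals
      (hii _ hfi 0 p le_rfl hp (hpq.trans hq)) (hii _ hfi p q hp hpq hq)]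
    abel
  have hlip : ∀ p q, 0 ≤ p → p ≤ q → q ≤ T → ‖φ q - φ p‖ ≤ K * (q - p) := by
    intro p q hp hpq hq
    rw [hdiff p q hp hpq hq, ← abs_of_nonneg (sub_nonneg.2 hpq)]
    apply intervalIntegral.norm_integral_le_of_norm_le_const
    intro r hr
    rw [uIoc_of_le hpq] at hr
    have hr' : r ∈ Icc 0 T := ⟨hp.trans hr.1.le, hr.2.trans hq⟩
    exact hK _ _ (hφ r hr') (huM r hr')
  refine ⟨hlip s t hs hst ht, ∫ r in s..t, u r, ?_, ?_⟩
  · rw [mul_comm]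
    nth_rewrite 1 [← abs_of_nonneg (sub_nonneg.2 hst)]
    apply intervalIntegral.norm_integral_le_of_norm_le_const
    intro r hr
    rw [uIoc_of_le hst] at hr
    exact huM r ⟨hs.trans hr.1.le, hr.2.trans ht⟩
  · have e : φ t - φ s - (t - s) • A.mulVec (φ s) - B.mulVec (∫ r in s..t, u r) =
        ∫ r in s..t, A.mulVec (φ r - φ s) := by
      have iA : IntervalIntegrable (fun r => LA (φ r)) volume s t :=
        hii _ (LA.integrable_comp hφi) s t hs hst ht
      have iB : IntervalIntegrable (fun r => LB (u r)) volume s t :=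
        hii _ (LB.integrable_comp hui) s t hs hst ht
      rw [hdiff s t hs hst ht]
      simp only [← hLA, ← hLB, map_sub]
      rw [intervalIntegral.integral_add iA iB, intervalIntegral.integral_sub iA (by simp),
        intervalIntegral.integral_const, LB.intervalIntegral_comp_comm (hii _ hui s t hs hst ht)]
      abel
    rw [e]
    have : a * K * (t - s) ^ 2 = (a * (K * (t - s))) * |t - s| := by
      rw [abs_of_nonneg (sub_nonneg.2 hst)]; ring
    rw [this]
    apply intervalIntegral.norm_integral_le_of_norm_le_const
    intro r hr
    rw [uIoc_of_le hst] at hr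
    refine (ha _).trans (mul_le_mul_of_nonneg_left ?_ ha0)
    refine (hlip s r hs hr.1.le (hr.2.trans ht)).trans ?_
    exact mul_le_mul_of_nonneg_left (by linarith [hr.2]) hK0

lemma forward_aux {n m : ℕ} (A : Matrix (Fin n) (Fin n) ℝ) (B : Matrix (Fin n) (Fin m) ℝ)
    (X X' : Set (Fin n → ℝ))
    (hX : IsNPolytope X) (hX' : IsNPolytope X')
    (h0 : (0 : Fin n → ℝ) ∈ interior X) (p : Fin n → ℝ) (hp : p ∈ interior X) (hp0 : p ≠ 0)
    (hRIBC : RIBC A B 0 X X') :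
    (∃ X₁ : Set (Fin n → ℝ), IsCompact X₁ ∧ Convex ℝ X₁ ∧ (interior X₁).Nonempty ∧
      X ⊆ X₁ ∧ X₁ ⊆ X' ∧
      ∀ x ∈ frontier X₁, ∃ u : Fin m → ℝ, A.mulVec x + B.mulVec u ∈ bouligand X₁ x) := by
  obtain ⟨M, hM, hR⟩ := hRIBC
  obtain ⟨⟨V, hV⟩, -⟩ := hX
  obtain ⟨⟨V', hV'⟩, -⟩ := hX'
  have hXc : Convex ℝ X := hV ▸ convex_convexHull ℝ _
  have hX'c : Convex ℝ X' := hV' ▸ convex_convexHull ℝ _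
  have hX'k : IsCompact X' := hV' ▸ V'.finite_toSet.isCompact_convexHull ℝ
  obtain ⟨R, hRb⟩ := hX'k.isBounded.exists_norm_le
  obtain ⟨LA, hLA⟩ := clm_mulVec A
  obtain ⟨LB, hLB⟩ := clm_mulVec B
  set a := ‖LA‖ with ha
  have ha0 : 0 ≤ a := norm_nonneg _
  have haA : ∀ v, ‖A.mulVec v‖ ≤ a * ‖v‖ := fun v => hLA v ▸ LA.le_opNorm v
  obtain ⟨K, hK0, hK⟩ : ∃ K > 0, ∀ v w, ‖v‖ ≤ R → ‖w‖ ≤ M →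
      ‖A.mulVec v + B.mulVec w‖ ≤ K := by
    refine ⟨a * |R| + ‖LB‖ * M + 1, by positivity, fun v w hv hw => ?_⟩
    refine (norm_add_le _ _).trans ?_
    have h1 := (haA v).trans (mul_le_mul_of_nonneg_left (hv.trans (le_abs_self R)) ha0)
    have h2 := (LB.le_opNorm w).trans (mul_le_mul_of_nonneg_left hw (norm_nonneg _))
    rw [hLB] at h2
    linarith
  set Y : Set (Fin n → ℝ) := {z | ∃ T ≥ (0 : ℝ), ∃ u : ℝ → Fin m → ℝ, ∃ φ : ℝ → Fin n → ℝ,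
      Measurable u ∧ IsSol A B 0 u φ T ∧ φ T ∈ interior X ∧
      (∀ t ∈ Set.Icc (0 : ℝ) T, ‖u t‖ ≤ M) ∧
      (∀ t ∈ Set.Icc (0 : ℝ) T, φ t ∈ interior X') ∧
      (φ 0 ∈ interior X) ∧ ∃ t ∈ Icc 0 T, φ t = z} with hY
  have hXY : interior X ⊆ Y := by
    intro x hx
    obtain ⟨T, hT, u, φ, h1, h2, h3, h4, h5, h6⟩ := hR x hx x hx
    exact ⟨T, hT, u, φ, h1, h2, h4 ▸ hx, h5, h6, h3 ▸ hx, 0, ⟨le_rfl, hT⟩, h3⟩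
  have hYX' : Y ⊆ X' := by
    rintro z ⟨T, hT, u, φ, h1, h2, h3, h4, h5, h6, t, ht, rfl⟩
    exact interior_subset (h5 t ht)
  have hpn : 0 < ‖p‖ := norm_pos_iff.2 hp0
  set δ := ‖p‖ / (2 * K) with hδ
  have hδ0 : 0 < δ := by positivity
  have hYstep : ∀ z ∈ Y, ∀ t : ℝ, 0 < t → t ≤ δ → ∃ w : Fin m → ℝ, ‖w‖ ≤ t * M ∧ ∃ c ∈ Y,
      ‖c - z - t • A.mulVec z - B.mulVec w‖ ≤ (a * K) * t ^ 2 := by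
    rintro z ⟨T, hT, u, φ, h1, h2, h3, h4, h5, h6, s, hs, rfl⟩ t ht0 htδ
    have hst := step_aux A B u φ T M R a K hT h1 h2 h4
      (fun t ht => hRb _ (interior_subset (h5 t ht))) haA ha0 hK0.le hK
    rcases le_or_gt (s + t) T with hle | hgt
    · obtain ⟨-, w, hw, hw2⟩ := hst s (s + t) hs.1 (by linarith) hle
      rw [add_sub_cancel_left] at hw hw2
      exact ⟨w, hw, φ (s + t), ⟨T, hT, u, φ, h1, h2, h3, h4, h5, h6, s + t,
        ⟨by linarith [hs.1], hle⟩, rfl⟩, hw2⟩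
    · obtain ⟨hl1, w1, hw1, hw12⟩ := hst s T hs.1 hs.2 le_rfl
      obtain ⟨y', hy', hd⟩ : ∃ y' ∈ interior X, ‖p‖ / 2 ≤ ‖y' - φ T‖ := by
        by_contra! hcon
        have c1 := hcon 0 h0
        have c2 := hcon p hp
        have : ‖p‖ ≤ ‖p - φ T‖ + ‖0 - φ T‖ := by
          have := norm_sub_le (p - φ T) (0 - φ T)
          simpa using this
        linarith
      obtain ⟨T', hT', u', φ', g1, g2, g3, g4, g5, g6⟩ := hR (φ T) h3 y' hy'
      have hst' := step_aux A B u' φ' T' M R a K hT' g1 g2 g5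
        (fun t ht => hRb _ (interior_subset (g6 t ht))) haA ha0 hK0.le hK
      have hT'δ : δ ≤ T' := by
        have := (hst' 0 T' le_rfl hT' le_rfl).1
        rw [g4, g3, sub_zero] at this
        rw [hδ, div_le_iff₀ (by positivity)]
        linarith
      have hs2 := hs.2
      obtain ⟨-, w2, hw2, hw22⟩ := hst' 0 (t - (T - s)) le_rfl (by linarith) (by linarith)
      rw [sub_zero, g3] at hw22
      rw [sub_zero] at hw2
      refine ⟨w1 + w2, ?_, φ' (t - (T - s)), ⟨T', hT', u', φ', g1, g2, g4 ▸ hy', g5, g6,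
        g3 ▸ h3, _, ⟨by linarith, by linarith⟩, rfl⟩, ?_⟩
      · refine (norm_add_le _ _).trans ?_
        linarith
      · generalize φ' (t - (T - s)) = c at *
        obtain ⟨q, hq⟩ : ∃ q, q = T - s := ⟨_, rfl⟩
        rw [← hq] at hl1 hw1 hw12 hw22
        have hq0 : 0 ≤ q := by linarith
        have hqt : 0 ≤ t - q := by linarith
        have e : c - φ s - t • A.mulVec (φ s) - B.mulVec (w1 + w2) =
            (φ T - φ s - q • A.mulVec (φ s) - B.mulVec w1) +
            (c - φ T - (t - q) • A.mulVec (φ T) - B.mulVec w2) +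
            (t - q) • A.mulVec (φ T - φ s) := by
          rw [Matrix.mulVec_add, Matrix.mulVec_sub]
          module
        rw [e]
        refine norm_add₃_le.trans ?_
        rw [norm_smul, Real.norm_of_nonneg hqt]
        have h7 := mul_le_mul_of_nonneg_left
          ((haA (φ T - φ s)).trans (mul_le_mul_of_nonneg_left hl1 ha0)) hqt
        have h8 : 0 ≤ a * K * (q * (t - q)) := by positivity
        nlinarith
  set C := closure (convexHull ℝ Y) with hC
  have hCc : Convex ℝ C := (convex_convexHull ℝ Y).closure
  have hCX' : C ⊆ X' := closure_minimal (convexHull_min hYX' hX'c) hX'k.isClosed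
  have hCk : IsCompact C := hX'k.of_isClosed_subset isClosed_closure hCX'
  have hYC : Y ⊆ C := (subset_convexHull ℝ Y).trans subset_closure
  have hXC : X ⊆ C := by
    have h1 : closure (interior X) = closure X :=
      hXc.closure_interior_eq_closure_of_nonempty_interior ⟨0, h0⟩
    refine subset_closure.trans (h1 ▸ ?_)
    exact closure_minimal (hXY.trans hYC) isClosed_closure
  refine ⟨C, hCk, hCc, ⟨0, interior_mono hXC h0⟩, hXC, hCX', fun x hx => ?_⟩
  have hxC : x ∈ C := isClosed_closure.frontier_subset hx
  refine tangent_aux A B C x M (a * K) δ hδ0 fun t ht0 htδ => ?_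
  obtain ⟨k1, k2⟩ := closed_aux A B C hCk hCc (t * M) (a * K * t ^ 2) t
  refine closure_minimal (convexHull_min ?_ k2) k1 hxC
  intro z hz
  obtain ⟨w, hw, c, hc, h⟩ := hYstep z hz t ht0 htδ
  exact ⟨w, hw, c, hYC hc, h⟩

lemma reverse_aux {n m : ℕ} (A : Matrix (Fin n) (Fin n) ℝ) (B : Matrix (Fin n) (Fin m) ℝ)
    (X X' : Set (Fin n → ℝ)) (hX' : IsNPolytope X')
    (hRIBC : RIBC A B 0 X X') : RIBC (-A) (-B) 0 X X' := by
  obtain ⟨M, hM, hR⟩ := hRIBC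
  obtain ⟨⟨V', hV'⟩, -⟩ := hX'
  have hX'k : IsCompact X' := hV' ▸ V'.finite_toSet.isCompact_convexHull ℝ
  obtain ⟨R, hRb⟩ := hX'k.isBounded.exists_norm_le
  refine ⟨M, hM, fun x hx y hy => ?_⟩
  obtain ⟨T, hT, u, φ, h1, h2, h3, h4, h5, h6⟩ := hR y hy x hx
  have hmem : ∀ t ∈ Icc (0 : ℝ) T, T - t ∈ Icc (0 : ℝ) T := fun t ht =>
    ⟨by linarith [ht.2], by linarith [ht.1]⟩
  refine ⟨T, hT, fun t => u (T - t), fun t => φ (T - t), h1.comp (by fun_prop), ?_,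
    by simpa using h4, by simpa using h3, fun t ht => h5 _ (hmem t ht),
    fun t ht => h6 _ (hmem t ht)⟩
  obtain ⟨hui, hφi⟩ := integ_aux A B u φ T M R hT h1 h2 h5
    (fun t ht => hRb _ (interior_subset (h6 t ht)))
  obtain ⟨LA, hLA⟩ := clm_mulVec A
  obtain ⟨LB, hLB⟩ := clm_mulVec B
  have hfi : IntegrableOn (fun r => A.mulVec (φ r) + B.mulVec (u r)) (Icc 0 T) := by
    have : Integrable (fun r => LA (φ r) + LB (u r)) (volume.restrict (Icc 0 T)) :=
      (LA.integrable_comp hφi).add (LB.integrable_comp hui)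
    simpa only [hLA, hLB, IntegrableOn] using this
  have hii : ∀ p q, 0 ≤ p → p ≤ q → q ≤ T → IntervalIntegrable
      (fun r => A.mulVec (φ r) + B.mulVec (u r)) volume p q := by
    intro p q hp hpq hq
    rw [intervalIntegrable_iff_integrableOn_Icc_of_le hpq]
    exact hfi.mono_set (Icc_subset_Icc hp hq)
  intro t ht
  have e1 := h2 (T - t) (hmem t ht)
  have e2 := h2 T ⟨hT, le_rfl⟩
  simp only [add_zero] at e1 e2
  have e3 : ∀ s, (-A).mulVec (φ (T - s)) + (-B).mulVec (u (T - s)) + 0 =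
      -(A.mulVec (φ (T - s)) + B.mulVec (u (T - s))) := by
    intro s
    rw [Matrix.neg_mulVec, Matrix.neg_mulVec]; abel
  simp only [e3, sub_zero]
  rw [intervalIntegral.integral_neg, intervalIntegral.integral_comp_sub_left
    (fun r => A.mulVec (φ r) + B.mulVec (u r)) T, sub_zero, e1, e2,
    ← intervalIntegral.integral_add_adjacent_intervals
      (hii 0 (T - t) le_rfl (hmem t ht).1 (hmem t ht).2)
      (hii (T - t) T (hmem t ht).1 (hmem t ht).2 le_rfl)]
  abel

lemma ctrb_aux {n m : ℕ} (A : Matrix (Fin n) (Fin n) ℝ) (B : Matrix (Fin n) (Fin m) ℝ)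
    (X X' : Set (Fin n → ℝ)) (hX' : IsNPolytope X') (h0 : (0 : Fin n → ℝ) ∈ interior X)
    (hRIBC : RIBC A B 0 X X') : Controllable A B := by
  obtain ⟨M, hM, hR⟩ := hRIBC
  obtain ⟨⟨V', hV'⟩, -⟩ := hX'
  have hX'k : IsCompact X' := hV' ▸ V'.finite_toSet.isCompact_convexHull ℝ
  obtain ⟨R, hRb⟩ := hX'k.isBounded.exists_norm_le
  by_contra hcon
  obtain ⟨p, hp0, hp⟩ : ∃ p : Fin n → ℝ, p ≠ 0 ∧ p ᵥ* ctrbMat A B = 0 := by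
    by_contra! hno
    apply hcon
    have hinj : Function.Injective fun v => v ᵥ* ctrbMat A B := by
      intro v w hvw
      by_contra hne
      refine hno (v - w) (sub_ne_zero.2 hne) ?_
      rw [Matrix.sub_vecMul]
      exact sub_eq_zero.2 hvw
    have := (Matrix.vecMul_injective_iff.1 hinj).rank_matrix
    simpa [Controllable] using this
  have hlt : ∀ k < n, p ᵥ* (A ^ k * B) = 0 := by
    intro k hk
    ext j
    have := congrFun hp (⟨k, hk⟩, j)
    simpa [Matrix.vecMul, dotProduct, ctrbMat] using this
  have hall : ∀ k, p ᵥ* (A ^ k * B) = 0 := by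
    intro k
    rcases Nat.eq_zero_or_pos n with hn | hn
    · subst hn
      exact absurd (Subsingleton.elim p 0) hp0
    have : Nonempty (Fin n) := ⟨⟨0, hn⟩⟩
    have hdeg : (Polynomial.X ^ k %ₘ A.charpoly).natDegree < n := by
      have h1 := Polynomial.natDegree_modByMonic_lt (Polynomial.X ^ k) A.charpoly_monic
        (by
          intro h
          have := A.charpoly_natDegree_eq_dim
          rw [h] at this
          simp at this
          omega)
      rwa [A.charpoly_natDegree_eq_dim, Fintype.card_fin] at h1
    rw [Matrix.pow_eq_aeval_mod_charpoly, Polynomial.aeval_eq_sum_range' hdeg, Matrix.sum_mul,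
      Matrix.vecMul_sum]
    refine Finset.sum_eq_zero fun i hi => ?_
    rw [Matrix.smul_mul, Matrix.vecMul_smul, hlt i (Finset.mem_range.1 hi), smul_zero]
  -- a multiple of `p` lies in the interior
  obtain ⟨ε, hε, hεX⟩ : ∃ ε : ℝ, 0 < ε ∧ ε • p ∈ interior X := by
    have hc : Filter.Tendsto (fun t : ℝ => t • p) (nhdsWithin 0 (Ioi 0)) (nhds 0) := by
      have : Continuous fun t : ℝ => t • p := by fun_prop
      have := this.tendsto 0
      rw [zero_smul] at this
      exact this.mono_left nhdsWithin_le_nhds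
    have h1 := hc.eventually (isOpen_interior.mem_nhds h0)
    obtain ⟨t, ht1, ht2⟩ := (h1.and self_mem_nhdsWithin).exists
    exact ⟨t, ht2, ht1⟩
  obtain ⟨T, hT, u, φ, h1, h2, h3, h4, h5, h6⟩ := hR 0 h0 _ hεX
  have hφR : ∀ t ∈ Icc (0 : ℝ) T, ‖φ t‖ ≤ R := fun t ht => hRb _ (interior_subset (h6 t ht))
  obtain ⟨hui, hφi⟩ := integ_aux A B u φ T M R hT h1 h2 h5 hφR
  obtain ⟨LA, hLA⟩ := clm_mulVec A
  obtain ⟨LB, hLB⟩ := clm_mulVec B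
  have hfi : IntegrableOn (fun r => A.mulVec (φ r) + B.mulVec (u r)) (Icc 0 T) := by
    have : Integrable (fun r => LA (φ r) + LB (u r)) (volume.restrict (Icc 0 T)) :=
      (LA.integrable_comp hφi).add (LB.integrable_comp hui)
    simpa only [hLA, hLB, IntegrableOn] using this
  obtain ⟨ℓ, hℓ⟩ : ∃ ℓ : (Fin n → ℝ) →L[ℝ] ℝ, ∀ v, ℓ v = p ⬝ᵥ v :=
    ⟨LinearMap.toContinuousLinearMap (dotProductBilin ℝ ℝ p), fun _ => rfl⟩
  have hℓk : ∀ k v, (ℓ.comp (LA ^ k)) v = p ⬝ᵥ (A ^ k).mulVec v := by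
    intro k v
    rw [ContinuousLinearMap.comp_apply, hℓ]
    congr 1
    induction k generalizing v with
    | zero => simp
    | succ k ih =>
      rw [pow_succ, mul_apply_eq_comp, ih, hLA, pow_succ, Matrix.mulVec_mulVec]
  have hgk : ∀ k, ∀ t ∈ Icc (0 : ℝ) T, ℓ ((LA ^ k) (φ t)) =
      ∫ s in (0 : ℝ)..t, ℓ ((LA ^ (k + 1)) (φ s)) := by
    intro k t ht
    have e := h2 t ht
    simp only [add_zero] at e
    rw [h3, zero_add] at e
    have hint : IntervalIntegrable (fun r => A.mulVec (φ r) + B.mulVec (u r)) volume 0 t := by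
      rw [intervalIntegrable_iff_integrableOn_Icc_of_le ht.1]
      exact hfi.mono_set (Icc_subset_Icc le_rfl ht.2)
    have e2 := (ℓ.comp (LA ^ k)).intervalIntegral_comp_comm hint
    rw [← e] at e2
    rw [← ContinuousLinearMap.comp_apply, ← e2]
    congr 1
    ext r
    rw [hℓk, Matrix.mulVec_add, dotProduct_add, Matrix.mulVec_mulVec, Matrix.mulVec_mulVec,
      Matrix.dotProduct_mulVec p (A ^ k * B), hall k, zero_dotProduct, add_zero,
      ← ContinuousLinearMap.comp_apply, hℓk, pow_succ]
  set a := ‖LA‖ with ha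
  have ha0 : 0 ≤ a := norm_nonneg _
  set D := ‖ℓ‖ * |R| with hD
  have hbound : ∀ j k, ∀ t ∈ Icc (0 : ℝ) T,
      ‖ℓ ((LA ^ k) (φ t))‖ ≤ D * a ^ (k + j) * (t ^ j / j.factorial) := by
    intro j
    induction j with
    | zero =>
      intro k t ht
      have q1 := ℓ.le_opNorm ((LA ^ k) (φ t))
      have q2 : ‖(LA ^ k) (φ t)‖ ≤ a ^ k * ‖φ t‖ := by
        clear q1
        generalize φ t = v
        clear ht
        induction k generalizing v with
        | zero => simp
        | succ k ih =>
          rw [pow_succ, mul_apply_eq_comp, pow_succ, mul_assoc]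
          exact (ih _).trans (mul_le_mul_of_nonneg_left (LA.le_opNorm v) (by positivity))
      have q3 : ‖φ t‖ ≤ |R| := (hφR t ht).trans (le_abs_self R)
      have q4 := q2.trans (mul_le_mul_of_nonneg_left q3 (by positivity : 0 ≤ a ^ k))
      have q5 := q1.trans (mul_le_mul_of_nonneg_left q4 (norm_nonneg ℓ))
      simp only [add_zero, pow_zero, Nat.factorial_zero, Nat.cast_one, div_one, mul_one]
      calc _ ≤ _ := q5
        _ = _ := by rw [hD]; ring
    | succ j ih =>
      intro k t ht
      rw [hgk k t ht]
      have hle := intervalIntegral.norm_integral_le_of_norm_le (μ := volume) ht.1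
        (f := fun s => ℓ ((LA ^ (k + 1)) (φ s)))
        (g := fun s => D * a ^ (k + 1 + j) * (s ^ j / j.factorial))
        (Filter.Eventually.of_forall fun s hs => ih (k + 1) s ⟨hs.1.le, hs.2.trans ht.2⟩)
        (Continuous.intervalIntegrable (by fun_prop) _ _)
      refine hle.trans (le_of_eq ?_)
      rw [intervalIntegral.integral_const_mul, intervalIntegral.integral_div, integral_pow,
        Nat.factorial_succ, show k + 1 + j = k + (j + 1) by ring]
      push_cast
      have : (0 : ℝ) < j.factorial := by positivity
      simp only [ne_eq, Nat.add_eq_zero_iff, one_ne_zero, and_false, not_false_eq_true, zero_pow,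
        sub_zero]
      field_simp
  have hz : ‖ℓ (φ T)‖ ≤ 0 := by
    have hl := (FloorSemiring.tendsto_pow_div_factorial_atTop (a * T)).const_mul D
    rw [mul_zero] at hl
    refine ge_of_tendsto' hl fun j => ?_
    have := hbound j 0 T ⟨hT, le_rfl⟩
    rw [pow_zero, one_apply_eq_self] at this
    refine this.trans (le_of_eq ?_)
    rw [zero_add, mul_pow]; ring
  rw [norm_le_zero_iff, h4, hℓ, dotProduct_smul, smul_eq_mul] at hz
  rcases mul_eq_zero.1 hz with h | h
  · exact hε.ne' h
  · exact hp0 (dotProduct_self_eq_zero.1 h)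

/-- For the linear system with `0 ∈ X° ⊂ X'°`, RIBC w.r.t. `X` through `X'`
implies: (i) `(A,B)` controllable; (ii) some compact convex `X₁`, `X ⊆ X₁ ⊆ X'`, with solvable
invariance conditions; (iii) some compact convex `X₂`, `X ⊆ X₂ ⊆ X'`, with solvable backward
invariance conditions. -/
theorem stmt6 {n m : ℕ} (A : Matrix (Fin n) (Fin n) ℝ) (B : Matrix (Fin n) (Fin m) ℝ)
    (hB : B.rank = m) (X X' : Set (Fin n → ℝ))
    (hX : IsNPolytope X) (hX' : IsNPolytope X')
    (h0 : (0 : Fin n → ℝ) ∈ interior X) (hXX' : interior X ⊂ interior X')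
    (hRIBC : RIBC A B 0 X X') :
    Controllable A B ∧
    (∃ X₁ : Set (Fin n → ℝ), IsCompact X₁ ∧ Convex ℝ X₁ ∧ (interior X₁).Nonempty ∧
      X ⊆ X₁ ∧ X₁ ⊆ X' ∧
      ∀ x ∈ frontier X₁, ∃ u : Fin m → ℝ, A.mulVec x + B.mulVec u ∈ bouligand X₁ x) ∧
    (∃ X₂ : Set (Fin n → ℝ), IsCompact X₂ ∧ Convex ℝ X₂ ∧ (interior X₂).Nonempty ∧
      X ⊆ X₂ ∧ X₂ ⊆ X' ∧
      ∀ x ∈ frontier X₂, ∃ u : Fin m → ℝ,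
        -(A.mulVec x) - B.mulVec u ∈ bouligand X₂ x) := by
  obtain ⟨q, hq, hq0⟩ : ∃ q ∈ interior X, q ≠ 0 := by
    obtain ⟨q, -, hq⟩ := Set.exists_of_ssubset hXX'
    have hq0 : q ≠ 0 := fun h => hq (h ▸ h0)
    have hc : Filter.Tendsto (fun t : ℝ => t • q) (nhdsWithin 0 (Ioi 0)) (nhds 0) := by
      have : Continuous fun t : ℝ => t • q := by fun_prop
      have := this.tendsto 0
      rw [zero_smul] at this
      exact this.mono_left nhdsWithin_le_nhds
    have h1 := hc.eventually (isOpen_interior.mem_nhds h0)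
    obtain ⟨t, ht1, ht2⟩ := (h1.and self_mem_nhdsWithin).exists
    exact ⟨t • q, ht1, smul_ne_zero (ne_of_gt ht2) hq0⟩
  refine ⟨ctrb_aux A B X X' hX' h0 hRIBC,
    forward_aux A B X X' hX hX' h0 q hq hq0 hRIBC, ?_⟩
  obtain ⟨X₂, k1, k2, k3, k4, k5, k6⟩ := forward_aux (-A) (-B) X X' hX hX' h0 q hq hq0
    (reverse_aux A B X X' hX' hRIBC)
  refine ⟨X₂, k1, k2, k3, k4, k5, fun x hx => ?_⟩
  obtain ⟨u, hu⟩ := k6 x hx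
  refine ⟨u, ?_⟩
  rwa [Matrix.neg_mulVec, Matrix.neg_mulVec, ← sub_eq_add_neg] at hu
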